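/- Let (φ_i, ξ_i, η_i), i = 1,2,3, be an abelian almost 3-contact structure on a finite-dimensional real Lie algebra 𝔤. For each i = 1,2,3, the kernel of ad_{ξ_i} restricted to 𝔥 equals the kernel of ψ, and the image of ad_{ξ_i} restricted to 𝔥 equals the image of ψ. Both of these subspaces of 𝔥 are invariant under φ_j for every j = 1,2,3 and under ψ; consequently their dimensions are divisible by 4. -/

import Mathlib

/-- `(i,j,k)` is an even permutation of `(1,2,3)` (indexed here as `(0,1,2)`). -/
def evenPerm (i j k : Fin 3) : Prop :=
  (i, j, k) = ((0 : Fin 3), (1 : Fin 3), (2 : Fin 3)) ∨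
  (i, j, k) = ((1 : Fin 3), (2 : Fin 3), (0 : Fin 3)) ∨
  (i, j, k) = ((2 : Fin 3), (0 : Fin 3), (1 : Fin 3))

/-- An abelian almost 3-contact structure on a real Lie algebra `L`: three almost
contact structures `(φ i, ξ i, η i)` satisfying the quaternionic-like compatibility
relations for every even permutation `(i,j,k)` of `(1,2,3)`, each of which is abelian. -/
structure AbelianAC3 (L : Type*) [LieRing L] [LieAlgebra ℝ L] where
  φ : Fin 3 → (L →ₗ[ℝ] L)
  ξ : Fin 3 → L
  η : Fin 3 → (L →ₗ[ℝ] ℝ)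
  acs : ∀ i, ∀ x : L, φ i (φ i x) = -x + η i x • ξ i
  unit : ∀ i, η i (ξ i) = 1
  comp_phi : ∀ i j k, evenPerm i j k → ∀ x : L, φ k x = φ i (φ j x) - η j x • ξ i
  comp_phi' : ∀ i j k, evenPerm i j k → ∀ x : L, φ k x = -φ j (φ i x) + η i x • ξ j
  comp_xi : ∀ i j k, evenPerm i j k → φ i (ξ j) = ξ k
  comp_xi' : ∀ i j k, evenPerm i j k → φ j (ξ i) = -ξ k
  comp_eta : ∀ i j k, evenPerm i j k → ∀ x : L, η i (φ j x) = η k x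
  comp_eta' : ∀ i j k, evenPerm i j k → ∀ x : L, η j (φ i x) = -η k x
  abelian_ad : ∀ i, ∀ x : L, ⁅ξ i, φ i x⁆ = φ i ⁅ξ i, x⁆
  abelian_br : ∀ i, ∀ X Y : L, η i X = 0 → η i Y = 0 → ⁅φ i X, φ i Y⁆ = ⁅X, Y⁆

namespace AbelianAC3

variable {L : Type*} [LieRing L] [LieAlgebra ℝ L]

/-- Membership in the horizontal subspace `𝔥 = ⋂ ker (η i)`. -/
def inH (S : AbelianAC3 L) (x : L) : Prop := ∀ i, S.η i x = 0

/-- The horizontal subspace `𝔥` as a submodule. -/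
def H (S : AbelianAC3 L) : Submodule ℝ L :=
  LinearMap.ker (S.η 0) ⊓ LinearMap.ker (S.η 1) ⊓ LinearMap.ker (S.η 2)

/-- The vertical subspace `𝔳 = span{ξ₁, ξ₂, ξ₃}`. -/
def V (S : AbelianAC3 L) : Submodule ℝ L :=
  Submodule.span ℝ {S.ξ 0, S.ξ 1, S.ξ 2}

/-- The endomorphism `ψ(X) = [ξ₁, φ₁ X]` (as a linear map on all of `L`). -/
def psi (S : AbelianAC3 L) : L →ₗ[ℝ] L :=
  (LieAlgebra.ad ℝ L (S.ξ 0)) ∘ₗ (S.φ 0)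

/-- The distinguished horizontal vector `𝒵 = φ₁([ξ₂, ξ₃])`. -/
def Z (S : AbelianAC3 L) : L := S.φ 0 ⁅S.ξ 1, S.ξ 2⁆

end AbelianAC3

open Quaternion in
theorem Module.four_dvd_finrank_of_anticomm {V : Type*} [AddCommGroup V] [Module ℝ V]
    (A B : Module.End ℝ V) (hA : A * A = -1) (hB : B * B = -1) (hAB : B * A = -(A * B)) :
    4 ∣ Module.finrank ℝ V := by
  let q : QuaternionAlgebra.Basis (Module.End ℝ V) (-1 : ℝ) 0 (-1) :=
    { i := A
      j := B
      k := A * B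
      i_mul_i := by simp [hA]
      j_mul_j := by simp [hB]
      i_mul_j := rfl
      j_mul_i := by simp [hAB] }
  let f : ℍ[ℝ] →ₐ[ℝ] Module.End ℝ V := q.liftHom
  let : Module ℍ[ℝ] V := Module.compHom V f.toRingHom
  have : IsScalarTower ℝ ℍ[ℝ] V := ⟨fun r x v => by
    change f (r • x) v = r • f x v
    rw [map_smul, LinearMap.smul_apply]⟩
  have h := Module.finrank_mul_finrank ℝ ℍ[ℝ] V
  rw [Quaternion.finrank_eq_four] at h
  exact Dvd.intro _ h

theorem evenPerm.rotate {i j k : Fin 3} (h : evenPerm i j k) : evenPerm j k i := by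
  rcases h with h | h | h <;>
    obtain ⟨rfl, rfl, rfl⟩ := (by simpa using h) <;> simp [evenPerm]

theorem evenPerm.exists_of_fst (i : Fin 3) : ∃ j k, evenPerm i j k := by
  fin_cases i
  exacts [⟨1, 2, .inl rfl⟩, ⟨2, 0, .inr (.inl rfl)⟩, ⟨0, 1, .inr (.inr rfl)⟩]

theorem evenPerm.eq_or_eq_or_eq {i j k : Fin 3} (h : evenPerm i j k) (l : Fin 3) :
    l = i ∨ l = j ∨ l = k := by
  rcases h with h | h | h <;>
    obtain ⟨rfl, rfl, rfl⟩ := (by simpa using h) <;> fin_cases l <;> simp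

namespace AbelianAC3

variable {L : Type*} [LieRing L] [LieAlgebra ℝ L] (S : AbelianAC3 L) {i j k : Fin 3} {x : L}

theorem mem_H : x ∈ S.H ↔ ∀ i, S.η i x = 0 := by
  simp [H, Fin.forall_fin_succ, and_assoc]

theorem phi_xi_self (i : Fin 3) : S.φ i (S.ξ i) = 0 := by
  have h0 : S.φ i (S.φ i (S.ξ i)) = 0 := by rw [S.acs, S.unit]; simp
  have h1 : S.φ i (S.ξ i) = S.η i (S.φ i (S.ξ i)) • S.ξ i := by
    have h := S.acs i (S.φ i (S.ξ i))
    rw [h0, map_zero] at h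
    exact (neg_add_eq_zero.mp h.symm)
  have h2 : S.η i (S.φ i (S.ξ i)) * S.η i (S.φ i (S.ξ i)) = 0 := by
    have h := congrArg (S.φ i) h1
    rw [h0, map_smul] at h
    simpa using (congrArg (S.η i) h).symm
  rw [h1, mul_self_eq_zero.mp h2, zero_smul]

theorem eta_phi_self (i : Fin 3) (x : L) : S.η i (S.φ i x) = 0 := by
  have h := S.acs i (S.φ i x)
  rw [S.acs i x, map_add, map_neg, map_smul, S.phi_xi_self, smul_zero, add_zero] at h
  simpa [S.unit] using congrArg (S.η i) h

theorem eta_xi_snd (h : evenPerm i j k) : S.η i (S.ξ j) = 0 := by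
  rw [← neg_eq_zero, ← map_neg, ← S.comp_xi' k i j h.rotate.rotate, S.eta_phi_self]

theorem eta_xi_thd (h : evenPerm i j k) : S.η i (S.ξ k) = 0 := by
  rw [← S.comp_xi i j k h, S.eta_phi_self]

theorem phi_mem_H (hx : x ∈ S.H) (i : Fin 3) : S.φ i x ∈ S.H := by
  obtain ⟨j, k, h⟩ := evenPerm.exists_of_fst i
  rw [mem_H] at hx ⊢
  intro l
  obtain rfl | rfl | rfl := h.eq_or_eq_or_eq l
  · exact S.eta_phi_self _ x
  · rw [S.comp_eta' _ _ _ h, hx, neg_zero]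
  · rw [S.comp_eta _ _ _ h.rotate.rotate, hx]

theorem phi_phi_of_mem_H (hx : x ∈ S.H) (i : Fin 3) : S.φ i (S.φ i x) = -x := by
  rw [S.acs, (S.mem_H.mp hx) i, zero_smul, add_zero]

theorem phi_phi_eq (h : evenPerm i j k) (hx : x ∈ S.H) : S.φ i (S.φ j x) = S.φ k x := by
  rw [S.comp_phi i j k h, S.mem_H.mp hx, zero_smul, sub_zero]

theorem phi_phi_eq_neg (h : evenPerm i j k) (hx : x ∈ S.H) : S.φ j (S.φ i x) = -S.φ k x := by
  rw [S.comp_phi' i j k h, S.mem_H.mp hx, zero_smul, add_zero, neg_neg]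

theorem lie_xi_thd_phi (h : evenPerm i j k) (hx : x ∈ S.H) : ⁅S.ξ k, S.φ i x⁆ = ⁅S.ξ j, x⁆ := by
  rw [← S.comp_xi i j k h, S.abelian_br i _ _ (S.eta_xi_snd h) (S.mem_H.mp hx i)]

theorem lie_xi_snd_phi (h : evenPerm i j k) (hx : x ∈ S.H) : ⁅S.ξ j, S.φ i x⁆ = -⁅S.ξ k, x⁆ := by
  rw [← S.abelian_br i _ _ (S.eta_xi_thd h) (S.mem_H.mp hx i),
    S.comp_xi' k i j h.rotate.rotate, neg_lie, neg_neg]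

theorem psi_eq_lie (hx : x ∈ S.H) (i : Fin 3) : S.psi x = ⁅S.ξ i, S.φ i x⁆ := by
  have key {i j k : Fin 3} (h : evenPerm i j k) : ⁅S.ξ j, S.φ j x⁆ = ⁅S.ξ i, S.φ i x⁆ := by
    rw [← S.phi_phi_eq h.rotate.rotate hx,
      S.lie_xi_thd_phi h.rotate.rotate (S.phi_mem_H hx i)]
  have h : evenPerm 0 1 2 := .inl rfl
  change ⁅S.ξ 0, S.φ 0 x⁆ = _
  obtain rfl | rfl | rfl := h.eq_or_eq_or_eq i
  · rfl
  · exact (key h).symm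
  · exact key h.rotate.rotate

theorem psi_eq_phi_lie (hx : x ∈ S.H) (i : Fin 3) : S.psi x = S.φ i ⁅S.ξ i, x⁆ := by
  rw [S.psi_eq_lie hx i, S.abelian_ad]

theorem lie_xi_eq_psi (hx : x ∈ S.H) (i : Fin 3) : ⁅S.ξ i, x⁆ = S.psi (-S.φ i x) := by
  rw [map_neg, S.psi_eq_lie (S.phi_mem_H hx i) i, S.phi_phi_of_mem_H hx, lie_neg, neg_neg]

theorem lie_xi_mem_H (hx : x ∈ S.H) (i : Fin 3) : ⁅S.ξ i, x⁆ ∈ S.H := by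
  have self {y : L} (hy : y ∈ S.H) (l : Fin 3) : S.η l ⁅S.ξ l, y⁆ = 0 := by
    rw [← neg_eq_zero, ← map_neg, ← lie_neg, ← S.phi_phi_of_mem_H hy l, S.abelian_ad,
      S.eta_phi_self]
  obtain ⟨j, k, h⟩ := evenPerm.exists_of_fst i
  rw [mem_H]
  intro l
  obtain rfl | rfl | rfl := h.eq_or_eq_or_eq l
  · exact self hx _
  · rw [← S.lie_xi_thd_phi h.rotate.rotate hx, self (S.phi_mem_H hx _)]
  · rw [← neg_neg ⁅S.ξ i, x⁆, ← S.lie_xi_snd_phi h.rotate hx, map_neg,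
      self (S.phi_mem_H hx _), neg_zero]

theorem psi_mem_H (hx : x ∈ S.H) : S.psi x ∈ S.H :=
  S.lie_xi_mem_H (S.phi_mem_H hx 0) 0

theorem psi_phi (hx : x ∈ S.H) (i : Fin 3) : S.psi (S.φ i x) = S.φ i (S.psi x) := by
  rw [S.psi_eq_phi_lie (S.phi_mem_H hx i) i, S.psi_eq_lie hx i]

theorem four_dvd_finrank_of_le_H {W : Submodule ℝ L} (hW : W ≤ S.H)
    (hφ : ∀ j, ∀ x ∈ W, S.φ j x ∈ W) : 4 ∣ Module.finrank ℝ W := by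
  refine Module.four_dvd_finrank_of_anticomm ((S.φ 0).restrict (hφ 0)) ((S.φ 1).restrict (hφ 1))
    ?_ ?_ ?_
  · ext x
    simpa using S.phi_phi_of_mem_H (hW x.2) 0
  · ext x
    simpa using S.phi_phi_of_mem_H (hW x.2) 1
  · ext x
    have h : evenPerm 0 1 2 := .inl rfl
    simpa [S.phi_phi_eq h (hW x.2)] using S.phi_phi_eq_neg h (hW x.2)

theorem phi_mem_H_inf_ker_psi (j : Fin 3) :
    ∀ x ∈ S.H ⊓ LinearMap.ker S.psi, S.φ j x ∈ S.H ⊓ LinearMap.ker S.psi := by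
  rintro x ⟨hx, hk⟩
  refine ⟨S.phi_mem_H hx j, ?_⟩
  change S.psi (S.φ j x) = 0
  rw [S.psi_phi hx, LinearMap.mem_ker.mp hk, map_zero]

theorem map_psi_H_le : Submodule.map S.psi S.H ≤ S.H := by
  rintro _ ⟨x, hx, rfl⟩
  exact S.psi_mem_H hx

theorem phi_mem_map_psi_H (j : Fin 3) :
    ∀ x ∈ Submodule.map S.psi S.H, S.φ j x ∈ Submodule.map S.psi S.H := by
  rintro _ ⟨x, hx, rfl⟩
  exact ⟨S.φ j x, S.phi_mem_H hx j, S.psi_phi hx j⟩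

theorem lie_xi_eq_zero_iff (hx : x ∈ S.H) (i : Fin 3) : ⁅S.ξ i, x⁆ = 0 ↔ S.psi x = 0 := by
  rw [S.psi_eq_phi_lie hx i]
  refine ⟨fun h => by rw [h, map_zero], fun h => ?_⟩
  rw [← neg_eq_zero, ← S.phi_phi_of_mem_H (S.lie_xi_mem_H hx i) i, h, map_zero]

end AbelianAC3

/-- for each `i`, the kernel (resp. image) of `ad_{ξ_i}|_𝔥` equals the
kernel (resp. image) of `ψ|_𝔥`; these subspaces are invariant under each `φ_j` and under
`ψ`, and their dimensions are divisible by `4`. -/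
theorem AbelianAC3.ker_im_psi
    {L : Type*} [LieRing L] [LieAlgebra ℝ L] [FiniteDimensional ℝ L]
    (S : AbelianAC3 L) :
    (∀ i, S.H ⊓ LinearMap.ker (LieAlgebra.ad ℝ L (S.ξ i)) = S.H ⊓ LinearMap.ker S.psi) ∧
    (∀ i, Submodule.map (LieAlgebra.ad ℝ L (S.ξ i)) S.H = Submodule.map S.psi S.H) ∧
    (∀ j, Submodule.map (S.φ j) (S.H ⊓ LinearMap.ker S.psi) ≤ S.H ⊓ LinearMap.ker S.psi) ∧
    (∀ j, Submodule.map (S.φ j) (Submodule.map S.psi S.H) ≤ Submodule.map S.psi S.H) ∧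
    Submodule.map S.psi (S.H ⊓ LinearMap.ker S.psi) ≤ S.H ⊓ LinearMap.ker S.psi ∧
    Submodule.map S.psi (Submodule.map S.psi S.H) ≤ Submodule.map S.psi S.H ∧
    (4 ∣ Module.finrank ℝ ↥(S.H ⊓ LinearMap.ker S.psi)) ∧
    (4 ∣ Module.finrank ℝ ↥(Submodule.map S.psi S.H)) := by
  refine ⟨fun i => ?_, fun i => ?_, fun j => Submodule.map_le_iff_le_comap.mpr
      (S.phi_mem_H_inf_ker_psi j), fun j => Submodule.map_le_iff_le_comap.mpr
      (S.phi_mem_map_psi_H j), ?_, Submodule.map_mono S.map_psi_H_le,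
    S.four_dvd_finrank_of_le_H inf_le_left S.phi_mem_H_inf_ker_psi,
    S.four_dvd_finrank_of_le_H S.map_psi_H_le S.phi_mem_map_psi_H⟩
  · ext x
    exact and_congr_right fun hx => S.lie_xi_eq_zero_iff hx i
  · apply le_antisymm
    · rintro _ ⟨x, hx, rfl⟩
      exact ⟨-S.φ i x, neg_mem (S.phi_mem_H hx i), (S.lie_xi_eq_psi hx i).symm⟩
    · rintro _ ⟨x, hx, rfl⟩
      exact ⟨S.φ i x, S.phi_mem_H hx i, (S.psi_eq_lie hx i).symm⟩
  · rintro _ ⟨x, hx, rfl⟩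
    rw [LinearMap.mem_ker.mp hx.2]
    exact zero_mem _
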